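/- arXiv:1506.05376 — 3 statements merged into one kernel-verified Lean document; each statement's English description precedes it below -/
import Mathlib

section
/- For every k ≥ 0, the stop-after-first-rejection balance is dominated by the retrial balance: B_ℓ(k) ≤ b̄_ℓ(k). -/
/-- Partial sums of the purchase amounts: `S k = ξ_1 + ⋯ + ξ_k`,
where `ξ i` denotes the `(i+1)`-st purchase amount. -/
def partialSum (ξ : ℕ → ℝ) (k : ℕ) : ℝ := ∑ i ∈ Finset.range k, ξ i

/-- Stop-after-first-rejection balance: `B_ℓ(k) = S_{min(k, K−1)}` where
`K = inf{j ≥ 1 : S_j > ℓ}`, and `B_ℓ(k) = S_k` if no such `j` exists. -/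
noncomputable def stopBalance (ξ : ℕ → ℝ) (ℓ : ℝ) (k : ℕ) : ℝ :=
  haveI : Decidable (∃ j, 1 ≤ j ∧ partialSum ξ j > ℓ) := Classical.propDecidable _
  if ∃ j, 1 ≤ j ∧ partialSum ξ j > ℓ then
    partialSum ξ (min k (sInf {j | 1 ≤ j ∧ partialSum ξ j > ℓ} - 1))
  else partialSum ξ k

/-- Retrial balance: `b̄_ℓ(0) = 0` and `b̄_ℓ(k) = b̄_ℓ(k−1) + ξ_k` if this does not
exceed `ℓ`, else `b̄_ℓ(k) = b̄_ℓ(k−1)`. -/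
noncomputable def retrialBalance (ξ : ℕ → ℝ) (ℓ : ℝ) : ℕ → ℝ
  | 0 => 0
  | k + 1 =>
    if retrialBalance ξ ℓ k + ξ k ≤ ℓ then retrialBalance ξ ℓ k + ξ k
    else retrialBalance ξ ℓ k

theorem partialSum_mono {ξ : ℕ → ℝ} (hξ : ∀ i, 0 ≤ ξ i) : Monotone (partialSum ξ) :=
  monotone_nat_of_le_succ fun n => by
    simpa [partialSum, Finset.sum_range_succ] using hξ n

theorem retrialBalance_mono {ξ : ℕ → ℝ} (hξ : ∀ i, 0 ≤ ξ i) (ℓ : ℝ) :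
    Monotone (retrialBalance ξ ℓ) :=
  monotone_nat_of_le_succ fun n => by
    rw [retrialBalance]
    split_ifs
    · exact le_add_of_nonneg_right (hξ n)
    · exact le_rfl

/-- Until the partial sums exceed the limit, every purchase is accepted. -/
theorem retrialBalance_eq_partialSum {ξ : ℕ → ℝ} (hξ : ∀ i, 0 ≤ ξ i) {ℓ : ℝ} {k : ℕ}
    (hk : partialSum ξ k ≤ ℓ) : retrialBalance ξ ℓ k = partialSum ξ k := by
  induction k with
  | zero => simp [retrialBalance, partialSum]
  | succ k ih =>
    have hsucc : partialSum ξ (k + 1) = partialSum ξ k + ξ k := Finset.sum_range_succ ξ k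
    rw [retrialBalance, ih ((partialSum_mono hξ k.le_succ).trans hk), ← hsucc, if_pos hk]

theorem stopBalance_le_retrialBalance (ξ : ℕ → ℝ) (hξ : ∀ i, 0 ≤ ξ i)
    (ℓ : ℝ) (hℓ : 0 ≤ ℓ) :
    ∀ k : ℕ, stopBalance ξ ℓ k ≤ retrialBalance ξ ℓ k := by
  intro k
  have key : ∀ m ≤ k, partialSum ξ m ≤ ℓ → partialSum ξ m ≤ retrialBalance ξ ℓ k :=
    fun m hmk hm => (retrialBalance_eq_partialSum hξ hm).symm.le.trans
      (retrialBalance_mono hξ ℓ hmk)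
  have zero_le_limit : partialSum ξ 0 ≤ ℓ := by simpa [partialSum] using hℓ
  unfold stopBalance
  split_ifs with h
  · refine key _ (min_le_left _ _) ?_
    set m := min k (sInf {j | 1 ≤ j ∧ partialSum ξ j > ℓ} - 1) with hm
    rcases Nat.eq_zero_or_pos m with h0 | hpos
    · rwa [h0]
    · have hlt : m < sInf {j | 1 ≤ j ∧ partialSum ξ j > ℓ} := by omega
      by_contra! hgt
      exact Nat.notMem_of_lt_sInf hlt ⟨hpos, hgt⟩
  · push Not at h
    refine key k le_rfl ?_
    rcases Nat.eq_zero_or_pos k with rfl | hpos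
    · exact zero_le_limit
    · exact h k hpos
end

section
/- If S satisfies the balance tail integral equation, then for all 0 < y ≤ ℓ and t ≥ 0, S_ℓ(y, t) ≤ G(t)·F(ℓ). -/
open MeasureTheory

theorem tail_function_bounded_by_GF
    (μ ν : Measure ℝ) [IsProbabilityMeasure μ] [IsProbabilityMeasure ν]
    (hμsupp : μ (Set.Iio 0) = 0) (hνsupp : ν (Set.Iio 0) = 0)
    (S : ℝ → ℝ → ℝ → ℝ)
    (hSmeas : Measurable fun p : ℝ × ℝ × ℝ => S p.1 p.2.1 p.2.2)
    (hS01 : ∀ ℓ y t : ℝ, S ℓ y t ∈ Set.Icc (0 : ℝ) 1)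
    (heq : ∀ ℓ y t : ℝ, 0 < y → y ≤ ℓ → 0 ≤ t →
      S ℓ y t =
        (∫ u in Set.Icc (0 : ℝ) t,
            (∫ z in Set.Icc (0 : ℝ) y, S (ℓ - z) (y - z) (t - u) ∂μ) ∂ν) +
          (ν (Set.Iic t)).toReal * ((μ (Set.Iic ℓ)).toReal - (μ (Set.Iic y)).toReal)) :
    ∀ ℓ y t : ℝ, 0 < y → y ≤ ℓ → 0 ≤ t →
      S ℓ y t ≤ (ν (Set.Iic t)).toReal * (μ (Set.Iic ℓ)).toReal := by
  intro ℓ y t hy hyl ht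
  rw [heq ℓ y t hy hyl ht]
  have inner_le : ∀ u, ‖∫ z in Set.Icc (0 : ℝ) y, S (ℓ - z) (y - z) (t - u) ∂μ‖
      ≤ μ.real (Set.Iic y) := fun u => by
    refine (norm_setIntegral_le_of_norm_le_const (C := 1) (measure_lt_top _ _)
      fun z _ => ?_).trans ?_
    · rw [Real.norm_of_nonneg (hS01 _ _ _).1]
      exact (hS01 _ _ _).2
    · rw [one_mul]
      exact measureReal_mono Set.Icc_subset_Iic_self
  have outer_le : ∫ u in Set.Icc (0 : ℝ) t,
      (∫ z in Set.Icc (0 : ℝ) y, S (ℓ - z) (y - z) (t - u) ∂μ) ∂ν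
      ≤ μ.real (Set.Iic y) * ν.real (Set.Iic t) :=
    ((le_abs_self _).trans (norm_setIntegral_le_of_norm_le_const (measure_lt_top _ _)
      fun u _ => inner_le u)).trans
      (mul_le_mul_of_nonneg_left (measureReal_mono Set.Icc_subset_Iic_self) measureReal_nonneg)
  simp only [measureReal_def] at outer_le
  linarith
end

section
/- Suppose S satisfies the balance tail integral equation and that G(0) = 0 (so that g̃(ω) < 1 for every ω > 0). Then for all real θ > 0, ω > 0, ψ > 0, the triple Laplace transform of S is given in closed form by S̃(θ, ω, ψ) = g̃(ω)·(f̃(θ) − f̃(θ+ψ)) / (θωψ·(1 − g̃(ω)·f̃(θ+ψ))). -/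
open MeasureTheory Real

theorem integral_iterated_eq_integral_prod {F : ℝ × ℝ × ℝ → ℝ} (hF : Integrable F) :
    (∫ t, ∫ l, ∫ y, F (t, l, y)) = ∫ x, F x := by
  have hF' : Integrable F (volume.prod (volume.prod volume)) := hF
  rw [show (∫ x, F x) = ∫ x, F x ∂(volume.prod (volume.prod volume)) from rfl,
    integral_prod F hF']
  refine integral_congr_ae ?_
  filter_upwards [hF'.prod_right_ae] with t ht
  exact (integral_prod _ ht).symm

theorem setIntegral_Icc_zero_eq_integral (μ : Measure ℝ) (hμ : μ (Set.Iio 0) = 0) (f : ℝ → ℝ)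
    (y : ℝ) (hf : ∀ z, y < z → f z = 0) :
    ∫ z in Set.Icc (0 : ℝ) y, f z ∂μ = ∫ z, f z ∂μ := by
  rw [← integral_indicator measurableSet_Icc]
  refine integral_congr_ae ?_
  filter_upwards [measure_eq_zero_iff_ae_notMem.1 hμ] with z hz
  by_cases h : z ≤ y
  · exact Set.indicator_of_mem (Set.mem_Icc.2 ⟨by simpa using hz, h⟩) f
  · rw [Set.indicator_of_notMem (fun h' => h h'.2), hf z (not_le.1 h)]

theorem lintegral_Ici_exp_neg_mul {a : ℝ} (ha : 0 < a) (c : ℝ) :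
    ∫⁻ x in Set.Ici c, ENNReal.ofReal (exp (-(a * x))) =
      ENNReal.ofReal (exp (-(a * c)) / a) := by
  have h := integral_exp_mul_Ioi (a := -a) (by linarith) c
  have hi := integrableOn_exp_mul_Ioi (a := -a) (by linarith) c
  simp only [neg_mul] at h hi
  rw [setLIntegral_congr Ioi_ae_eq_Ici.symm,
    ← ofReal_integral_eq_lintegral_ofReal hi (ae_of_all _ fun x => (exp_pos _).le), h,
    neg_div_neg_eq]

theorem lintegral_Ioo_exp_neg_mul {a : ℝ} (ha : 0 < a) {c : ℝ} (hc : 0 ≤ c) :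
    ∫⁻ x in Set.Ioo 0 c, ENNReal.ofReal (exp (-(a * x))) =
      ENNReal.ofReal ((1 - exp (-(a * c))) / a) := by
  have hcont : Continuous fun x : ℝ => exp (-(a * x)) := by fun_prop
  have hi : IntegrableOn (fun x : ℝ => exp (-(a * x))) (Set.Ioc 0 c) :=
    (hcont.integrableOn_Icc).mono_set Set.Ioc_subset_Icc_self
  rw [setLIntegral_congr Ioo_ae_eq_Ioc,
    ← ofReal_integral_eq_lintegral_ofReal hi (ae_of_all _ fun x => (exp_pos _).le),
    ← intervalIntegral.integral_of_le hc]
  congr 1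
  have hd : ∀ x ∈ Set.uIcc 0 c, HasDerivAt (fun x => -exp (-(a * x)) / a) (exp (-(a * x))) x := by
    intro x _
    have h := (((hasDerivAt_id x).const_mul a).neg.exp.neg).div_const a
    refine h.congr_deriv ?_
    simp only [id, Pi.neg_apply]
    field_simp
  rw [intervalIntegral.integral_eq_sub_of_hasDerivAt hd (hcont.intervalIntegrable _ _)]
  simp only [mul_zero, neg_zero, exp_zero]
  ring

theorem integrable_exp_neg_mul_of_measure_Iio_eq_zero (μ : Measure ℝ) [IsProbabilityMeasure μ]
    (hμ : μ (Set.Iio 0) = 0) {a : ℝ} (ha : 0 ≤ a) : Integrable (fun z => exp (-(a * z))) μ := by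
  refine Integrable.mono' (integrable_const (1 : ℝ)) (by fun_prop) ?_
  filter_upwards [measure_eq_zero_iff_ae_notMem.1 hμ] with z hz
  have hz : 0 ≤ z := by simpa using hz
  rw [norm_of_nonneg (exp_pos _).le, exp_le_one_iff]
  nlinarith [mul_nonneg ha hz]

theorem integral_exp_neg_mul_le_one (μ : Measure ℝ) [IsProbabilityMeasure μ]
    (hμ : μ (Set.Iio 0) = 0) {a : ℝ} (ha : 0 ≤ a) : ∫ z, exp (-(a * z)) ∂μ ≤ 1 := by
  have h : ∫ z, exp (-(a * z)) ∂μ ≤ ∫ _, (1 : ℝ) ∂μ := by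
    refine integral_mono_ae (integrable_exp_neg_mul_of_measure_Iio_eq_zero μ hμ ha)
      (integrable_const _) ?_
    filter_upwards [measure_eq_zero_iff_ae_notMem.1 hμ] with z hz
    have hz : 0 ≤ z := by simpa using hz
    rw [exp_le_one_iff]
    nlinarith [mul_nonneg ha hz]
  simpa using h

theorem integral_exp_neg_mul_lt_one (ν : Measure ℝ) [IsProbabilityMeasure ν]
    (hν : ν (Set.Iic 0) = 0) {a : ℝ} (ha : 0 < a) : ∫ z, exp (-(a * z)) ∂ν < 1 := by
  have hν' : ν (Set.Iio 0) = 0 := measure_mono_null Set.Iio_subset_Iic_self hν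
  have hi := integrable_exp_neg_mul_of_measure_Iio_eq_zero ν hν' ha.le
  have hpos : ∀ᵐ z ∂ν, 0 < 1 - exp (-(a * z)) := by
    filter_upwards [measure_eq_zero_iff_ae_notMem.1 hν] with z hz
    have hz : 0 < z := by simpa using hz
    rw [sub_pos, exp_lt_one_iff]
    nlinarith [mul_pos ha hz]
  have h : 0 < ∫ z, (1 - exp (-(a * z))) ∂ν := by
    rw [integral_pos_iff_support_of_nonneg_ae (hpos.mono fun z hz => hz.le)
      ((integrable_const _).sub hi)]
    refine pos_iff_ne_zero.2 fun h0 => ?_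
    have hf : ∀ᵐ _ ∂ν, False := by
      filter_upwards [hpos, measure_eq_zero_iff_ae_notMem.1 h0] with z h1 h2
      exact h2 h1.ne'
    exact NeZero.ne ν (by simpa using hf)
  rw [integral_sub (integrable_const _) hi] at h
  simp at h
  linarith

/-- The balance tail integral equation, extended to all arguments and written in `ℝ≥0∞`. -/
theorem ofReal_tail_eq_lintegral
    (μ ν : Measure ℝ) [IsProbabilityMeasure μ] [IsProbabilityMeasure ν]
    (hμsupp : μ (Set.Iio 0) = 0) (hνsupp : ν (Set.Iio 0) = 0)
    (S : ℝ → ℝ → ℝ → ℝ)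
    (hSmeas : Measurable fun p : ℝ × ℝ × ℝ => S p.1 p.2.1 p.2.2)
    (hS01 : ∀ ℓ y t : ℝ, S ℓ y t ∈ Set.Icc (0 : ℝ) 1)
    (hSzero : ∀ ℓ y t : ℝ, ¬(0 < y ∧ y ≤ ℓ ∧ 0 ≤ t) → S ℓ y t = 0)
    (heq : ∀ ℓ y t : ℝ, 0 < y → y ≤ ℓ → 0 ≤ t →
      S ℓ y t =
        (∫ u in Set.Icc (0 : ℝ) t,
            (∫ z in Set.Icc (0 : ℝ) y, S (ℓ - z) (y - z) (t - u) ∂μ) ∂ν) +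
          (ν (Set.Iic t)).toReal * ((μ (Set.Iic ℓ)).toReal - (μ (Set.Iic y)).toReal))
    (ℓ y t : ℝ) :
    ENNReal.ofReal (S ℓ y t) =
      (∫⁻ p, ENNReal.ofReal (S (ℓ - p.2) (y - p.2) (t - p.1)) ∂(ν.prod μ)) +
      ∫⁻ p, {q : ℝ × ℝ | q.1 ≤ t ∧ q.2 ≤ ℓ ∧ 0 < y ∧ y < q.2}.indicator 1 p ∂(ν.prod μ) := by
  have hpos : ∀ᵐ p ∂(ν.prod μ), 0 ≤ p.1 ∧ 0 ≤ p.2 := by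
    have h1 : ∀ᵐ u ∂ν, 0 ≤ u := by
      filter_upwards [measure_eq_zero_iff_ae_notMem.1 hνsupp] with z hz
      simpa using hz
    have h2 : ∀ᵐ u ∂μ, 0 ≤ u := by
      filter_upwards [measure_eq_zero_iff_ae_notMem.1 hμsupp] with z hz
      simpa using hz
    filter_upwards [Measure.quasiMeasurePreserving_fst.ae h1,
      Measure.quasiMeasurePreserving_snd.ae h2] with p hp1 hp2
    exact ⟨hp1, hp2⟩
  by_cases hD : 0 < y ∧ y ≤ ℓ ∧ 0 ≤ t
  · obtain ⟨hy, hyl, ht⟩ := hD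
    have hint : Integrable (fun p : ℝ × ℝ => S (ℓ - p.2) (y - p.2) (t - p.1)) (ν.prod μ) := by
      refine Integrable.mono' (integrable_const (1 : ℝ)) ?_ (ae_of_all _ fun p => ?_)
      · exact (hSmeas.comp (g := fun p : ℝ × ℝ × ℝ => S p.1 p.2.1 p.2.2)
          (f := fun p : ℝ × ℝ => (ℓ - p.2, y - p.2, t - p.1)) (by fun_prop)).aestronglyMeasurable
      · rw [norm_of_nonneg (hS01 _ _ _).1]
        exact (hS01 _ _ _).2
    have hset : {q : ℝ × ℝ | q.1 ≤ t ∧ q.2 ≤ ℓ ∧ 0 < y ∧ y < q.2} =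
        Set.Iic t ×ˢ Set.Ioc y ℓ := by
      ext q
      simp only [Set.mem_ofPred_eq, Set.mem_prod, Set.mem_Iic, Set.mem_Ioc]
      tauto
    have hIoc : μ (Set.Ioc y ℓ) = ENNReal.ofReal
        ((μ (Set.Iic ℓ)).toReal - (μ (Set.Iic y)).toReal) := by
      rw [← Set.Iic_sdiff_Iic, measure_sdiff (Set.Iic_subset_Iic.2 hyl)
        measurableSet_Iic.nullMeasurableSet (measure_ne_top _ _),
        ENNReal.ofReal_sub _ ENNReal.toReal_nonneg, ENNReal.ofReal_toReal (measure_ne_top _ _),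
        ENNReal.ofReal_toReal (measure_ne_top _ _)]
    have hinner : ∀ u, ∫ z in Set.Icc (0 : ℝ) y, S (ℓ - z) (y - z) (t - u) ∂μ =
        ∫ z, S (ℓ - z) (y - z) (t - u) ∂μ := fun u =>
      setIntegral_Icc_zero_eq_integral μ hμsupp _ y fun z hz =>
        hSzero _ _ _ fun h => by linarith [h.1]
    have hdiff : 0 ≤ (μ (Set.Iic ℓ)).toReal - (μ (Set.Iic y)).toReal :=
      sub_nonneg.2 (ENNReal.toReal_mono (measure_ne_top _ _)
        (measure_mono (Set.Iic_subset_Iic.2 hyl)))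
    rw [heq ℓ y t hy hyl ht]
    simp only [hinner]
    rw [setIntegral_Icc_zero_eq_integral ν hνsupp _ t fun u hu => by
        rw [show (fun z => S (ℓ - z) (y - z) (t - u)) = 0 from
          funext fun z => hSzero _ _ _ fun h => by linarith [h.2.2]]
        simp,
      ← integral_prod (fun p : ℝ × ℝ => S (ℓ - p.2) (y - p.2) (t - p.1)) hint,
      ENNReal.ofReal_add (integral_nonneg fun p => (hS01 _ _ _).1)
        (mul_nonneg ENNReal.toReal_nonneg hdiff),
      ofReal_integral_eq_lintegral_ofReal hint (ae_of_all _ fun p => (hS01 _ _ _).1),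
      hset, lintegral_indicator_one (measurableSet_Iic.prod measurableSet_Ioc),
      Measure.prod_prod, hIoc, ENNReal.ofReal_mul ENNReal.toReal_nonneg,
      ENNReal.ofReal_toReal (measure_ne_top _ _)]
  · rw [hSzero _ _ _ hD, ENNReal.ofReal_zero, eq_comm, add_eq_zero]
    constructor <;> refine (lintegral_congr_ae ?_).trans lintegral_zero
    · filter_upwards [hpos] with p hp
      rw [hSzero, ENNReal.ofReal_zero]
      rintro ⟨h1, h2, h3⟩
      exact hD ⟨by linarith, by linarith, by linarith⟩
    · filter_upwards [hpos] with p hp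
      refine Set.indicator_of_notMem (fun h => hD ?_) _
      obtain ⟨h1, h2, h3, h4⟩ := h
      exact ⟨h3, by linarith, by linarith⟩

/-- The weight of the triple transform, in the variables `(t, ℓ, y)`. -/
noncomputable def tripleWeight (θ ω ψ : ℝ) (x : ℝ × ℝ × ℝ) : ENNReal :=
  ENNReal.ofReal (exp (-(ω * x.1 + θ * x.2.1 + ψ * x.2.2)))

@[fun_prop]
theorem measurable_tripleWeight (θ ω ψ : ℝ) : Measurable (tripleWeight θ ω ψ) := by
  unfold tripleWeight
  fun_prop

theorem tripleWeight_eq_mul (θ ω ψ : ℝ) (x : ℝ × ℝ × ℝ) :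
    tripleWeight θ ω ψ x = ENNReal.ofReal (exp (-(ω * x.1))) *
      (ENNReal.ofReal (exp (-(θ * x.2.1))) * ENNReal.ofReal (exp (-(ψ * x.2.2)))) := by
  rw [tripleWeight, ← ENNReal.ofReal_mul (exp_pos _).le, ← ENNReal.ofReal_mul (exp_pos _).le,
    ← exp_add, ← exp_add]
  ring_nf

theorem tripleWeight_add (θ ω ψ : ℝ) (x : ℝ × ℝ × ℝ) (p : ℝ × ℝ) :
    tripleWeight θ ω ψ (x + (p.1, p.2, p.2)) = ENNReal.ofReal (exp (-(ω * p.1))) *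
      ENNReal.ofReal (exp (-((θ + ψ) * p.2))) * tripleWeight θ ω ψ x := by
  simp only [tripleWeight, Prod.fst_add, Prod.snd_add]
  rw [← ENNReal.ofReal_mul (exp_pos _).le, ← exp_add, ← ENNReal.ofReal_mul (exp_pos _).le,
    ← exp_add]
  ring_nf

theorem lintegral_ofReal_exp_neg_mul (μ : Measure ℝ) [IsProbabilityMeasure μ]
    (hμ : μ (Set.Iio 0) = 0) {a : ℝ} (ha : 0 ≤ a) :
    ∫⁻ z, ENNReal.ofReal (exp (-(a * z))) ∂μ = ENNReal.ofReal (∫ z, exp (-(a * z)) ∂μ) :=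
  (ofReal_integral_eq_lintegral_ofReal (integrable_exp_neg_mul_of_measure_Iio_eq_zero μ hμ ha)
    (ae_of_all _ fun _ => (exp_pos _).le)).symm

theorem lintegral_tripleWeight_mul_shift (μ ν : Measure ℝ) [IsProbabilityMeasure μ]
    [IsProbabilityMeasure ν] (θ ω ψ : ℝ) {s : ℝ × ℝ × ℝ → ENNReal} (hs : Measurable s) :
    ∫⁻ x, tripleWeight θ ω ψ x * ∫⁻ p, s (x - (p.1, p.2, p.2)) ∂(ν.prod μ) =
      (∫⁻ u, ENNReal.ofReal (exp (-(ω * u))) ∂ν) *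
        (∫⁻ z, ENNReal.ofReal (exp (-((θ + ψ) * z))) ∂μ) *
        ∫⁻ x, tripleWeight θ ω ψ x * s x := by
  have hm : Measurable fun q : (ℝ × ℝ × ℝ) × (ℝ × ℝ) => s (q.1 - (q.2.1, q.2.2, q.2.2)) :=
    hs.comp (by fun_prop)
  calc
    _ = ∫⁻ x, ∫⁻ p, tripleWeight θ ω ψ x * s (x - (p.1, p.2, p.2)) ∂(ν.prod μ) :=
      lintegral_congr fun x => (lintegral_const_mul _ (hm.comp measurable_prodMk_left)).symm
    _ = ∫⁻ p, (∫⁻ x, tripleWeight θ ω ψ x * s (x - (p.1, p.2, p.2))) ∂(ν.prod μ) :=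
      lintegral_lintegral_swap
        (((measurable_tripleWeight θ ω ψ).comp measurable_fst).mul hm).aemeasurable
    _ = ∫⁻ p, (ENNReal.ofReal (exp (-(ω * p.1))) * ENNReal.ofReal (exp (-((θ + ψ) * p.2)))) *
          (∫⁻ x, tripleWeight θ ω ψ x * s x) ∂(ν.prod μ) := by
      refine lintegral_congr fun p => ?_
      have : (volume : Measure (ℝ × ℝ × ℝ)).IsAddRightInvariant :=
        Measure.prod.instIsAddRightInvariant
      rw [← lintegral_add_right_eq_self _ ((p.1, p.2, p.2) : ℝ × ℝ × ℝ),
        ← lintegral_const_mul _ (by fun_prop)]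
      refine lintegral_congr fun x => ?_
      rw [add_sub_cancel_right, tripleWeight_add, mul_assoc]
    _ = _ := by
      rw [lintegral_mul_const _ (by fun_prop),
        lintegral_prod_mul (f := fun u => ENNReal.ofReal (exp (-(ω * u))))
          (g := fun z => ENNReal.ofReal (exp (-((θ + ψ) * z)))) (by fun_prop) (by fun_prop)]

theorem lintegral_tripleWeight_mul_indicator {θ ω ψ : ℝ} (hθ : 0 < θ) (hω : 0 < ω) (hψ : 0 < ψ)
    (u : ℝ) {z : ℝ} (hz : 0 ≤ z) :
    ∫⁻ x : ℝ × ℝ × ℝ, tripleWeight θ ω ψ x *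
        {x : ℝ × ℝ × ℝ | u ≤ x.1 ∧ z ≤ x.2.1 ∧ 0 < x.2.2 ∧ x.2.2 < z}.indicator 1 x =
      ENNReal.ofReal (exp (-(ω * u)) / ω) *
        ENNReal.ofReal ((exp (-(θ * z)) - exp (-((θ + ψ) * z))) / (θ * ψ)) := by
  have hE (a : ℝ) : Measurable fun x : ℝ => ENNReal.ofReal (exp (-(a * x))) := by fun_prop
  have hprod : ∀ x : ℝ × ℝ × ℝ, tripleWeight θ ω ψ x *
        {x : ℝ × ℝ × ℝ | u ≤ x.1 ∧ z ≤ x.2.1 ∧ 0 < x.2.2 ∧ x.2.2 < z}.indicator 1 x =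
      (Set.Ici u).indicator (fun a => ENNReal.ofReal (exp (-(ω * a)))) x.1 *
        ((Set.Ici z).indicator (fun a => ENNReal.ofReal (exp (-(θ * a)))) x.2.1 *
          (Set.Ioo 0 z).indicator (fun a => ENNReal.ofReal (exp (-(ψ * a)))) x.2.2) := by
    intro x
    rw [tripleWeight_eq_mul]
    simp only [Set.indicator_apply, Set.mem_ofPred_eq, Set.mem_Ici, Set.mem_Ioo, Pi.one_apply]
    by_cases h1 : u ≤ x.1 <;> by_cases h2 : z ≤ x.2.1 <;>
      by_cases h3 : 0 < x.2.2 ∧ x.2.2 < z <;> simp [h1, h2, h3]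
  have m1 := (hE ω).indicator (measurableSet_Ici (a := u))
  have m2 := (hE θ).indicator (measurableSet_Ici (a := z))
  have m3 := (hE ψ).indicator (measurableSet_Ioo (a := 0) (b := z))
  have hexp : exp (-(θ * z)) / θ * ((1 - exp (-(ψ * z))) / ψ) =
      (exp (-(θ * z)) - exp (-((θ + ψ) * z))) / (θ * ψ) := by
    rw [show -((θ + ψ) * z) = -(θ * z) + -(ψ * z) by ring, exp_add]
    field_simp
  rw [lintegral_congr hprod, Measure.volume_eq_prod,
    lintegral_prod_mul (f := (Set.Ici u).indicator fun a => ENNReal.ofReal (exp (-(ω * a))))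
      (g := fun q : ℝ × ℝ => (Set.Ici z).indicator (fun a => ENNReal.ofReal (exp (-(θ * a)))) q.1 *
          (Set.Ioo 0 z).indicator (fun a => ENNReal.ofReal (exp (-(ψ * a)))) q.2)
      m1.aemeasurable
      ((m2.comp measurable_fst).mul (m3.comp measurable_snd)).aemeasurable,
    Measure.volume_eq_prod, lintegral_prod_mul m2.aemeasurable m3.aemeasurable,
    lintegral_indicator measurableSet_Ici, lintegral_indicator measurableSet_Ici,
    lintegral_indicator measurableSet_Ioo, lintegral_Ici_exp_neg_mul hω,
    lintegral_Ici_exp_neg_mul hθ, lintegral_Ioo_exp_neg_mul hψ hz,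
    ← ENNReal.ofReal_mul (by positivity), hexp]

theorem lintegral_tripleWeight_mul_source (μ ν : Measure ℝ) [IsProbabilityMeasure μ]
    [IsProbabilityMeasure ν] (hμsupp : μ (Set.Iio 0) = 0) (hνsupp : ν (Set.Iio 0) = 0)
    {θ ω ψ : ℝ} (hθ : 0 < θ) (hω : 0 < ω) (hψ : 0 < ψ) :
    ∫⁻ x : ℝ × ℝ × ℝ, tripleWeight θ ω ψ x * ∫⁻ p,
        {q : ℝ × ℝ | q.1 ≤ x.1 ∧ q.2 ≤ x.2.1 ∧ 0 < x.2.2 ∧ x.2.2 < q.2}.indicator 1 p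
          ∂(ν.prod μ) =
      ENNReal.ofReal ((∫ u, exp (-(ω * u)) ∂ν) / ω *
        (((∫ z, exp (-(θ * z)) ∂μ) - ∫ z, exp (-((θ + ψ) * z)) ∂μ) / (θ * ψ))) := by
  set A : Set ((ℝ × ℝ × ℝ) × (ℝ × ℝ)) :=
    {r | r.2.1 ≤ r.1.1 ∧ r.2.2 ≤ r.1.2.1 ∧ 0 < r.1.2.2 ∧ r.1.2.2 < r.2.2} with hA
  have hAm : MeasurableSet A := by
    simp only [hA, Set.ofPred_and]
    exact (measurableSet_le (by fun_prop) (by fun_prop)).inter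
      ((measurableSet_le (by fun_prop) (by fun_prop)).inter
        ((measurableSet_lt (by fun_prop) (by fun_prop)).inter
          (measurableSet_lt (by fun_prop) (by fun_prop))))
  have hm : Measurable (A.indicator (1 : (ℝ × ℝ × ℝ) × (ℝ × ℝ) → ENNReal)) :=
    measurable_one.indicator hAm
  have hz : ∀ᵐ p ∂(ν.prod μ), 0 ≤ p.2 := by
    have h2 : ∀ᵐ u ∂μ, 0 ≤ u := by
      filter_upwards [measure_eq_zero_iff_ae_notMem.1 hμsupp] with z hz
      simpa using hz
    exact Measure.quasiMeasurePreserving_snd.ae h2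
  have iω := integrable_exp_neg_mul_of_measure_Iio_eq_zero ν hνsupp hω.le
  have iθ := integrable_exp_neg_mul_of_measure_Iio_eq_zero μ hμsupp hθ.le
  have iθψ := integrable_exp_neg_mul_of_measure_Iio_eq_zero μ hμsupp (add_pos hθ hψ).le
  have iR : Integrable (fun z => (exp (-(θ * z)) - exp (-((θ + ψ) * z))) / (θ * ψ)) μ :=
    (iθ.sub iθψ).div_const (θ * ψ)
  have hR : 0 ≤ᵐ[μ] fun z => (exp (-(θ * z)) - exp (-((θ + ψ) * z))) / (θ * ψ) := by
    filter_upwards [measure_eq_zero_iff_ae_notMem.1 hμsupp] with z hz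
    have hz : 0 ≤ z := by simpa using hz
    refine div_nonneg (sub_nonneg.2 (exp_le_exp.2 ?_)) (by positivity)
    nlinarith [mul_nonneg hψ.le hz]
  calc
    _ = ∫⁻ x, ∫⁻ p, tripleWeight θ ω ψ x * A.indicator 1 (x, p) ∂(ν.prod μ) :=
      lintegral_congr fun x => (lintegral_const_mul _ (hm.comp measurable_prodMk_left)).symm
    _ = ∫⁻ p, (∫⁻ x, tripleWeight θ ω ψ x * A.indicator 1 (x, p)) ∂(ν.prod μ) :=
      lintegral_lintegral_swap
        (((measurable_tripleWeight θ ω ψ).comp measurable_fst).mul hm).aemeasurable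
    _ = ∫⁻ p, ENNReal.ofReal (exp (-(ω * p.1)) / ω) *
        ENNReal.ofReal ((exp (-(θ * p.2)) - exp (-((θ + ψ) * p.2))) / (θ * ψ)) ∂(ν.prod μ) := by
      refine lintegral_congr_ae ?_
      filter_upwards [hz] with p hp
      exact lintegral_tripleWeight_mul_indicator hθ hω hψ p.1 hp
    _ = _ := by
      rw [lintegral_prod_mul (f := fun u => ENNReal.ofReal (exp (-(ω * u)) / ω))
          (g := fun z => ENNReal.ofReal ((exp (-(θ * z)) - exp (-((θ + ψ) * z))) / (θ * ψ)))
          (by fun_prop) (by fun_prop),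
        ← ofReal_integral_eq_lintegral_ofReal (iω.div_const ω)
          (ae_of_all _ fun _ => by positivity),
        ← ofReal_integral_eq_lintegral_ofReal iR hR,
        ← ENNReal.ofReal_mul (integral_nonneg fun _ => by positivity), integral_div,
        integral_div, ← integral_sub iθ iθψ]

theorem integrable_exp_neg_mul_tail (S : ℝ → ℝ → ℝ → ℝ)
    (hSmeas : Measurable fun p : ℝ × ℝ × ℝ => S p.1 p.2.1 p.2.2)
    (hS01 : ∀ ℓ y t : ℝ, S ℓ y t ∈ Set.Icc (0 : ℝ) 1)
    (hSzero : ∀ ℓ y t : ℝ, ¬(0 < y ∧ y ≤ ℓ ∧ 0 ≤ t) → S ℓ y t = 0)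
    {θ ω ψ : ℝ} (hθ : 0 < θ) (hω : 0 < ω) (hψ : 0 < ψ) :
    Integrable fun x : ℝ × ℝ × ℝ =>
      exp (-(ω * x.1 + θ * x.2.1 + ψ * x.2.2)) * S x.2.1 x.2.2 x.1 := by
  have hI {a : ℝ} (ha : 0 < a) :
      Integrable ((Set.Ici (0 : ℝ)).indicator fun x => exp (-(a * x))) := by
    rw [integrable_indicator_iff measurableSet_Ici, integrableOn_Ici_iff_integrableOn_Ioi]
    have hi := integrableOn_exp_mul_Ioi (a := -a) (by linarith) 0
    simpa only [neg_mul] using hi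
  have hdom := (hI hω).mul_prod ((hI hθ).mul_prod (hI hψ))
  refine Integrable.mono' hdom ?_ (ae_of_all _ fun x => ?_)
  · have hSm : Measurable fun x : ℝ × ℝ × ℝ => S x.2.1 x.2.2 x.1 :=
      hSmeas.comp (g := fun p : ℝ × ℝ × ℝ => S p.1 p.2.1 p.2.2)
        (f := fun x : ℝ × ℝ × ℝ => (x.2.1, x.2.2, x.1)) (by fun_prop)
    exact Measurable.aestronglyMeasurable (by fun_prop)
  · by_cases hD : 0 < x.2.2 ∧ x.2.2 ≤ x.2.1 ∧ 0 ≤ x.1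
    · rw [norm_of_nonneg (mul_nonneg (exp_pos _).le (hS01 _ _ _).1),
        Set.indicator_of_mem (Set.mem_Ici.2 hD.2.2),
        Set.indicator_of_mem (Set.mem_Ici.2 (hD.1.le.trans hD.2.1)),
        Set.indicator_of_mem (Set.mem_Ici.2 hD.1.le), ← exp_add, ← exp_add]
      refine (mul_le_of_le_one_right (exp_pos _).le (hS01 _ _ _).2).trans (le_of_eq ?_)
      ring_nf
    · rw [hSzero _ _ _ hD, mul_zero, norm_zero]
      have hn (a b : ℝ) : 0 ≤ (Set.Ici (0 : ℝ)).indicator (fun x => exp (-(a * x))) b :=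
        Set.indicator_nonneg (fun _ _ => (exp_pos _).le) _
      exact mul_nonneg (hn _ _) (mul_nonneg (hn _ _) (hn _ _))



theorem tail_function_triple_laplace_transform
    (μ ν : Measure ℝ) [IsProbabilityMeasure μ] [IsProbabilityMeasure ν]
    (hμsupp : μ (Set.Iio 0) = 0) (hνsupp : ν (Set.Iio 0) = 0)
    (hG0 : ν (Set.Iic 0) = 0)
    (S : ℝ → ℝ → ℝ → ℝ)
    (hSmeas : Measurable fun p : ℝ × ℝ × ℝ => S p.1 p.2.1 p.2.2)
    (hS01 : ∀ ℓ y t : ℝ, 0 < y → y ≤ ℓ → 0 ≤ t → S ℓ y t ∈ Set.Icc (0 : ℝ) 1)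
    (hSzero : ∀ ℓ y t : ℝ, ¬(0 < y ∧ y ≤ ℓ ∧ 0 ≤ t) → S ℓ y t = 0)
    (heq : ∀ ℓ y t : ℝ, 0 < y → y ≤ ℓ → 0 ≤ t →
      S ℓ y t =
        (∫ u in Set.Icc (0 : ℝ) t,
            (∫ z in Set.Icc (0 : ℝ) y, S (ℓ - z) (y - z) (t - u) ∂μ) ∂ν) +
          (ν (Set.Iic t)).toReal * ((μ (Set.Iic ℓ)).toReal - (μ (Set.Iic y)).toReal))
    (θ ω ψ : ℝ) (hθ : 0 < θ) (hω : 0 < ω) (hψ : 0 < ψ) :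
    (∫ t in Set.Ioi (0 : ℝ), ∫ ℓ in Set.Ioi (0 : ℝ), ∫ y in Set.Ioc (0 : ℝ) ℓ,
        exp (-(ω * t + θ * ℓ + ψ * y)) * S ℓ y t) =
      (∫ u, exp (-(ω * u)) ∂ν) *
          ((∫ z, exp (-(θ * z)) ∂μ) - (∫ z, exp (-((θ + ψ) * z)) ∂μ)) /
        (θ * ω * ψ * (1 - (∫ u, exp (-(ω * u)) ∂ν) * (∫ z, exp (-((θ + ψ) * z)) ∂μ))) := by
  have hS01' : ∀ ℓ y t : ℝ, S ℓ y t ∈ Set.Icc (0 : ℝ) 1 := fun ℓ y t => by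
    by_cases h : 0 < y ∧ y ≤ ℓ ∧ 0 ≤ t
    · exact hS01 _ _ _ h.1 h.2.1 h.2.2
    · rw [hSzero _ _ _ h]
      simp
  have hint := integrable_exp_neg_mul_tail S hSmeas hS01' hSzero hθ hω hψ
  have hLHS : (∫ t in Set.Ioi (0 : ℝ), ∫ ℓ in Set.Ioi (0 : ℝ), ∫ y in Set.Ioc (0 : ℝ) ℓ,
        exp (-(ω * t + θ * ℓ + ψ * y)) * S ℓ y t) =
      ∫ x : ℝ × ℝ × ℝ, exp (-(ω * x.1 + θ * x.2.1 + ψ * x.2.2)) * S x.2.1 x.2.2 x.1 := by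
    rw [← integral_iterated_eq_integral_prod hint]
    have hy (t ℓ : ℝ) : ∫ y in Set.Ioc (0 : ℝ) ℓ, exp (-(ω * t + θ * ℓ + ψ * y)) * S ℓ y t =
        ∫ y, exp (-(ω * t + θ * ℓ + ψ * y)) * S ℓ y t :=
      setIntegral_eq_integral_of_forall_compl_eq_zero fun y hy => by
        rw [hSzero _ _ _ fun h => hy ⟨h.1, h.2.1⟩, mul_zero]
    simp only [hy]
    rw [← integral_Ici_eq_integral_Ioi, setIntegral_eq_integral_of_forall_compl_eq_zero]
    · refine integral_congr_ae (ae_of_all _ fun t => ?_)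
      refine setIntegral_eq_integral_of_forall_compl_eq_zero fun ℓ hℓ => ?_
      rw [← hy, Set.Ioc_eq_empty (by simpa using hℓ)]
      simp
    · intro t ht
      have h0 (ℓ y : ℝ) : S ℓ y t = 0 := hSzero _ _ _ fun h => ht h.2.2
      simp [h0]
  set s : ℝ × ℝ × ℝ → ENNReal := fun x => ENNReal.ofReal (S x.2.1 x.2.2 x.1) with hs
  have hsm : Measurable s :=
    (hSmeas.comp (g := fun p : ℝ × ℝ × ℝ => S p.1 p.2.1 p.2.2)
        (f := fun x : ℝ × ℝ × ℝ => (x.2.1, x.2.2, x.1)) (by fun_prop)).ennreal_ofReal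
  set j := ∫ x : ℝ × ℝ × ℝ, exp (-(ω * x.1 + θ * x.2.1 + ψ * x.2.2)) * S x.2.1 x.2.2 x.1 with hj
  have hj0 : 0 ≤ j := integral_nonneg fun x => mul_nonneg (exp_pos _).le (hS01' _ _ _).1
  have hJ : ∫⁻ x, tripleWeight θ ω ψ x * s x = ENNReal.ofReal j := by
    rw [hj, ofReal_integral_eq_lintegral_ofReal hint
      (ae_of_all _ fun x => mul_nonneg (exp_pos _).le (hS01' _ _ _).1)]
    exact lintegral_congr fun x => (ENNReal.ofReal_mul (exp_pos _).le).symm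
  have hmW : Measurable fun x => tripleWeight θ ω ψ x *
      ∫⁻ p, s (x - (p.1, p.2, p.2)) ∂(ν.prod μ) := by
    refine (measurable_tripleWeight θ ω ψ).mul (Measurable.lintegral_prod_right'
      (f := fun q : (ℝ × ℝ × ℝ) × (ℝ × ℝ) => s (q.1 - (q.2.1, q.2.2, q.2.2))) ?_)
    exact hsm.comp (by fun_prop)
  have key : ∫⁻ x, tripleWeight θ ω ψ x * s x = _ :=
    (lintegral_congr fun x => by
      rw [hs]
      dsimp only
      rw [ofReal_tail_eq_lintegral μ ν hμsupp hνsupp S hSmeas hS01' hSzero heq, mul_add]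
      rfl).trans (lintegral_add_left hmW _)
  rw [lintegral_tripleWeight_mul_shift μ ν θ ω ψ hsm,
    lintegral_tripleWeight_mul_source μ ν hμsupp hνsupp hθ hω hψ, hJ,
    lintegral_ofReal_exp_neg_mul ν hνsupp hω.le,
    lintegral_ofReal_exp_neg_mul μ hμsupp (add_pos hθ hψ).le] at key
  rw [hLHS]
  have hg1 := integral_exp_neg_mul_lt_one ν hG0 hω
  have hf1 := integral_exp_neg_mul_le_one μ hμsupp (add_pos hθ hψ).le
  have hg0 : 0 ≤ ∫ u, exp (-(ω * u)) ∂ν := integral_nonneg fun _ => (exp_pos _).le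
  have hf0 : 0 ≤ ∫ z, exp (-((θ + ψ) * z)) ∂μ := integral_nonneg fun _ => (exp_pos _).le
  have hff : ∫ z, exp (-((θ + ψ) * z)) ∂μ ≤ ∫ z, exp (-(θ * z)) ∂μ := by
    refine integral_mono_ae
      (integrable_exp_neg_mul_of_measure_Iio_eq_zero μ hμsupp (add_pos hθ hψ).le)
      (integrable_exp_neg_mul_of_measure_Iio_eq_zero μ hμsupp hθ.le) ?_
    filter_upwards [measure_eq_zero_iff_ae_notMem.1 hμsupp] with z hz
    have hz : 0 ≤ z := by simpa using hz
    refine exp_le_exp.2 ?_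
    nlinarith [mul_nonneg hψ.le hz]
  generalize (∫ u, exp (-(ω * u)) ∂ν) = g at *
  generalize (∫ z, exp (-((θ + ψ) * z)) ∂μ) = f' at *
  generalize (∫ z, exp (-(θ * z)) ∂μ) = f at *
  have hR : 0 ≤ g / ω * ((f - f') / (θ * ψ)) :=
    mul_nonneg (by positivity) (div_nonneg (sub_nonneg.2 hff) (by positivity))
  rw [← ENNReal.ofReal_mul hg0, ← ENNReal.ofReal_mul (mul_nonneg hg0 hf0),
    ← ENNReal.ofReal_add (by positivity) hR,
    ENNReal.ofReal_eq_ofReal_iff hj0 (by positivity)] at key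
  have hgf : 0 < 1 - g * f' := by nlinarith
  rw [eq_div_iff (by positivity)]
  field_simp at key
  linarith
end
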